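/- Let f : ℝ^d → ℝ be differentiable with L_f-Lipschitz gradient, and let r₁, r₂ : ℝ^d → ℝ be convex such that every subgradient of r₁ has norm at most G₁ and every subgradient of r₂ has norm at most G₂. Assume there exist μ > 0 and R₀ ≥ 0 such that for all x, y with ‖x − y‖ ≥ R₀ and all subgradients u₁ of r₁ at x, u₂ of r₂ at x, v₁ of r₁ at y, v₂ of r₂ at y: ⟨∇f(x) + u₁ − u₂ − ∇f(y) − v₁ + v₂, x − y⟩ ≥ μ‖x − y‖². Let λ, γ > 0. Define P(y) = prox_{γ r₁^λ}(y) and the drift b̄(y) = (1/λ)(P(y) − prox_{λ r₁}(P(y))) + ∇f(y) − (1/λ)(y − prox_{λ r₂}(y)). Then for all x, y with ‖x − y‖ ≥ max{R₀, (8G₁ + 4G₂)/μ}, one has ⟨b̄(x) − b̄(y), x − y⟩ ≥ (μ/2)‖x − y‖². -/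

import Mathlib

open scoped RealInnerProductSpace

/-- `u` is a subgradient of `g` at `x`. -/
def IsSubgradAt {d : ℕ} (g : EuclideanSpace ℝ (Fin d) → ℝ)
    (x u : EuclideanSpace ℝ (Fin d)) : Prop :=
  ∀ y, g x + ⟪u, y - x⟫ ≤ g y

theorem ConvexOn.exists_isSubgradAt {d : ℕ} {g : EuclideanSpace ℝ (Fin d) → ℝ}
    (hg : ConvexOn ℝ Set.univ g) (x : EuclideanSpace ℝ (Fin d)) :
    ∃ u, IsSubgradAt g x u := by
  have hcont : Continuous g := hg.locallyLipschitz.continuous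
  have hopen : IsOpen {p : EuclideanSpace ℝ (Fin d) × ℝ | p.1 ∈ Set.univ ∧ g p.1 < p.2} := by
    simpa using isOpen_lt (hcont.comp continuous_fst) continuous_snd
  obtain ⟨F, hF⟩ := geometric_hahn_banach_open_point (x := (x, g x))
    hg.convex_strict_epigraph hopen (by simp)
  set l := F.comp (ContinuousLinearMap.inl ℝ (EuclideanSpace ℝ (Fin d)) ℝ) with hl
  set c := F (0, 1) with hc
  have hF' : ∀ a b, F (a, b) = l a + b * c := by
    intro a b
    have hab : ((a, b) : EuclideanSpace ℝ (Fin d) × ℝ) = (a, 0) + b • (0, 1) := by simp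
    rw [hab, map_add, map_smul]
    simp [hl, hc]
  have hsep : ∀ a b, g a < b → l a + b * c < l x + g x * c := by
    intro a b hab
    rw [← hF', ← hF']
    exact hF (a, b) ⟨Set.mem_univ _, hab⟩
  have hc0 : c < 0 := by
    have := hsep x (g x + 1) (by linarith)
    linarith
  refine ⟨(InnerProductSpace.toDual ℝ _).symm ((-c)⁻¹ • l), fun y => ?_⟩
  rw [InnerProductSpace.toDual_symm_apply]
  refine le_of_forall_pos_lt_add fun ε hε => ?_
  have h := hsep y (g y + ε) (by linarith)
  have hdiv : (-c)⁻¹ * (l y - l x) < g y + ε - g x := by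
    rw [inv_mul_lt_iff₀ (by linarith)]
    linarith
  simp only [smul_apply, map_sub, smul_eq_mul] at hdiv ⊢
  linarith

theorem le_of_forall_le_add_mul {a b C : ℝ} (h : ∀ t, 0 < t → t ≤ 1 → a ≤ b + t * C) :
    a ≤ b := by
  by_contra! hab
  have h1 := h 1 one_pos le_rfl
  have hC : 0 < C := by linarith
  have h2 := h ((a - b) / (2 * C)) (div_pos (by linarith) (by linarith))
    ((div_le_one (by linarith)).2 (by linarith))
  have h3 : (a - b) / (2 * C) * C = (a - b) / 2 := by field_simp
  linarith

theorem ConvexOn.isSubgradAt_of_isMinOn_prox {d : ℕ} {g : EuclideanSpace ℝ (Fin d) → ℝ}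
    (hg : ConvexOn ℝ Set.univ g) {lam : ℝ} (hlam : 0 < lam) {x p : EuclideanSpace ℝ (Fin d)}
    (hp : IsMinOn (fun y => g y + ‖x - y‖ ^ 2 / (2 * lam)) Set.univ p) :
    IsSubgradAt g p ((1 / lam) • (x - p)) := by
  intro z
  refine le_of_forall_le_add_mul (C := ‖z - p‖ ^ 2 / (2 * lam)) fun t ht ht1 => ?_
  have hmin : g p + ‖x - p‖ ^ 2 / (2 * lam) ≤
      g ((1 - t) • p + t • z) + ‖x - ((1 - t) • p + t • z)‖ ^ 2 / (2 * lam) :=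
    hp (Set.mem_univ _)
  have hconv := hg.2 (Set.mem_univ p) (Set.mem_univ z) (sub_nonneg.2 ht1) ht.le (by ring)
  have hx : x - ((1 - t) • p + t • z) = (x - p) - t • (z - p) := by module
  have hsq : ‖(x - p) - t • (z - p)‖ ^ 2
      = ‖x - p‖ ^ 2 - 2 * (t * ⟪x - p, z - p⟫) + t ^ 2 * ‖z - p‖ ^ 2 := by
    rw [norm_sub_sq_real, inner_smul_right, norm_smul, mul_pow, Real.norm_eq_abs, sq_abs]
  rw [hx, hsq] at hmin
  simp only [smul_eq_mul] at hconv
  rw [real_inner_smul_left]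
  have hexp : (‖x - p‖ ^ 2 - 2 * (t * ⟪x - p, z - p⟫) + t ^ 2 * ‖z - p‖ ^ 2) / (2 * lam)
      = ‖x - p‖ ^ 2 / (2 * lam) - t * (1 / lam * ⟪x - p, z - p⟫)
        + t * (t * (‖z - p‖ ^ 2 / (2 * lam))) := by
    field_simp
  rw [hexp] at hmin
  refine le_of_mul_le_mul_left ?_ ht
  linarith

theorem IsSubgradAt.inner_sub_nonneg {d : ℕ} {g : EuclideanSpace ℝ (Fin d) → ℝ}
    {x y u v : EuclideanSpace ℝ (Fin d)} (hu : IsSubgradAt g x u) (hv : IsSubgradAt g y v) :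
    0 ≤ ⟪u - v, x - y⟫ := by
  have h1 := hu y
  have h2 := hv x
  rw [← neg_sub x y, inner_neg_right] at h1
  rw [inner_sub_left]
  linarith

theorem abs_real_inner_sub_le_of_norm_le {E : Type*} [NormedAddCommGroup E] [InnerProductSpace ℝ E]
    {u v : E} {G : ℝ} (hu : ‖u‖ ≤ G) (hv : ‖v‖ ≤ G) (w : E) :
    |⟪u - v, w⟫| ≤ 2 * G * ‖w‖ := by
  have h1 : ‖u - v‖ ≤ 2 * G := (norm_sub_le u v).trans (by linarith)
  exact (abs_real_inner_le_norm _ _).trans (mul_le_mul_of_nonneg_right h1 (norm_nonneg w))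

/-- Distant dissipativity of the auxiliary drift
`b̄(y) = ∇r₁^λ(P y) + ∇f(y) − ∇r₂^λ(y)` where `P = prox_{γ r₁^λ}`. -/
theorem bar_drift_distant_dissipative {d : ℕ}
    (f r1 r2 : EuclideanSpace ℝ (Fin d) → ℝ)
    (f' : EuclideanSpace ℝ (Fin d) → EuclideanSpace ℝ (Fin d))
    (Lf G1 G2 mu R0 lam gam : ℝ)
    (hf : ∀ x, HasGradientAt f (f' x) x)
    (hLf : ∀ x y, ‖f' x - f' y‖ ≤ Lf * ‖x - y‖)
    (hr1 : ConvexOn ℝ Set.univ r1) (hr2 : ConvexOn ℝ Set.univ r2)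
    (hG1 : ∀ x u, IsSubgradAt r1 x u → ‖u‖ ≤ G1)
    (hG2 : ∀ x u, IsSubgradAt r2 x u → ‖u‖ ≤ G2)
    (hmu : 0 < mu) (hR0 : 0 ≤ R0)
    (hdiss : ∀ x y u1 u2 v1 v2, R0 ≤ ‖x - y‖ →
      IsSubgradAt r1 x u1 → IsSubgradAt r2 x u2 →
      IsSubgradAt r1 y v1 → IsSubgradAt r2 y v2 →
      mu * ‖x - y‖ ^ 2 ≤ ⟪f' x + u1 - u2 - f' y - v1 + v2, x - y⟫)
    (hlam : 0 < lam) (hgam : 0 < gam)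
    (P prox1 prox2 : EuclideanSpace ℝ (Fin d) → EuclideanSpace ℝ (Fin d))
    (hP : ∀ x, IsMinOn
      (fun y => (⨅ z, (r1 z + ‖y - z‖ ^ 2 / (2 * lam))) + ‖x - y‖ ^ 2 / (2 * gam))
      Set.univ (P x))
    (hprox1 : ∀ x, IsMinOn (fun y => r1 y + ‖x - y‖ ^ 2 / (2 * lam)) Set.univ (prox1 x))
    (hprox2 : ∀ x, IsMinOn (fun y => r2 y + ‖x - y‖ ^ 2 / (2 * lam)) Set.univ (prox2 x))
    (bbar : EuclideanSpace ℝ (Fin d) → EuclideanSpace ℝ (Fin d))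
    (hbbar : ∀ y, bbar y = (1 / lam) • (P y - prox1 (P y)) + f' y
      - (1 / lam) • (y - prox2 y))
    (x y : EuclideanSpace ℝ (Fin d))
    (hxy : max R0 ((8 * G1 + 4 * G2) / mu) ≤ ‖x - y‖) :
    (mu / 2) * ‖x - y‖ ^ 2 ≤ ⟪bbar x - bbar y, x - y⟫ := by
  obtain ⟨u1, hu1⟩ := hr1.exists_isSubgradAt x
  obtain ⟨v1, hv1⟩ := hr1.exists_isSubgradAt y
  obtain ⟨u2, hu2⟩ := hr2.exists_isSubgradAt x
  obtain ⟨v2, hv2⟩ := hr2.exists_isSubgradAt y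
  have hdist := hdiss x y u1 u2 v1 v2 ((le_max_left _ _).trans hxy) hu1 hu2 hv1 hv2
  have hfar : 8 * G1 + 4 * G2 ≤ ‖x - y‖ * mu :=
    (div_le_iff₀ hmu).1 ((le_max_right _ _).trans hxy)
  have ha := hG1 _ _ (hr1.isSubgradAt_of_isMinOn_prox hlam (hprox1 (P x)))
  have hb := hG1 _ _ (hr1.isSubgradAt_of_isMinOn_prox hlam (hprox1 (P y)))
  have hp := hG2 _ _ (hr2.isSubgradAt_of_isMinOn_prox hlam (hprox2 x))
  have hq := hG2 _ _ (hr2.isSubgradAt_of_isMinOn_prox hlam (hprox2 y))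
  rw [hbbar, hbbar]
  generalize (1 / lam) • (P x - prox1 (P x)) = a at *
  generalize (1 / lam) • (P y - prox1 (P y)) = b at *
  generalize (1 / lam) • (x - prox2 x) = p at *
  generalize (1 / lam) • (y - prox2 y) = q at *
  have hab := (abs_le.1 (abs_real_inner_sub_le_of_norm_le ha hb (x - y))).1
  have hpq := (abs_le.1 (abs_real_inner_sub_le_of_norm_le hp hq (x - y))).2
  have huv1 := (abs_le.1 (abs_real_inner_sub_le_of_norm_le (hG1 _ _ hu1) (hG1 _ _ hv1) (x - y))).2
  have huv2 := hu2.inner_sub_nonneg hv2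
  have hsplit : a + f' x - p - (b + f' y - q) = (f' x + u1 - u2 - f' y - v1 + v2)
      + (a - b) - (p - q) - (u1 - v1) + (u2 - v2) := by abel
  rw [hsplit, inner_add_left, inner_sub_left, inner_sub_left, inner_add_left]
  have hmul := mul_le_mul_of_nonneg_right hfar (norm_nonneg (x - y))
  linarith
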